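/- Let p > 0 and 0 < γ < 1. Then S_{1,p}(γ) = (i p / γ) ∑_{k≥1} ( K_2(2√(p(k + iγ))) / (k + iγ) − K_2(2√(p(k − iγ))) / (k − iγ) ), where complex square roots are principal and the right-hand side is a real number (i times a difference of complex conjugates). -/

import Mathlib

open Real MeasureTheory

/-- Bessel function of the first kind of integer order, via Bessel's integral. -/
noncomputable def besselJ (m : ℤ) (x : ℝ) : ℝ :=
  (1 / Real.pi) * ∫ θ in (0:ℝ)..Real.pi, Real.cos ((m : ℝ) * θ - x * Real.sin θ)

/-- Modified Bessel function of the second kind (real argument). -/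
noncomputable def besselK (ν x : ℝ) : ℝ :=
  ∫ t in Set.Ioi (0:ℝ), Real.exp (-x * Real.cosh t) * Real.cosh (ν * t)

/-- Modified Bessel function of the second kind (complex argument). -/
noncomputable def besselKC (ν : ℝ) (z : ℂ) : ℂ :=
  ∫ t in Set.Ioi (0:ℝ), Complex.exp (-z * (Real.cosh t : ℂ)) * (Real.cosh (ν * t) : ℂ)

/-- The p-extended Riemann zeta function. -/
noncomputable def zetaP (p α : ℝ) : ℝ :=
  (1 / Real.Gamma α) *
    ∫ t in Set.Ioi (0:ℝ), t ^ (α - 1) * Real.exp (-p / t) / (Real.exp t - 1)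

/-- The p-extended Mathieu series. -/
noncomputable def mathieuS (μ p r : ℝ) : ℝ :=
  2 * ∑' n : ℕ, (-1 : ℝ) ^ n *
      (Real.Gamma (μ + n + 1) / (n.factorial * Real.Gamma (μ + 1))) *
      zetaP p (2 * μ + 2 * n + 1) * r ^ (2 * n)

/-- A Laplace-type integral that converges absolutely for every positive parameter is holomorphic
in the right half-plane. -/
theorem differentiableOn_integral_cexp_neg_mul {μ : Measure ℝ} {φ w : ℝ → ℝ}
    (hφ : Measurable φ) (hw : Measurable w) (hφ0 : ∀ᵐ t ∂μ, 0 ≤ φ t)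
    (hint : ∀ x : ℝ, 0 < x → Integrable (fun t => Real.exp (-x * φ t) * w t) μ) :
    DifferentiableOn ℂ (fun z : ℂ => ∫ t, Complex.exp (-z * (φ t : ℂ)) * (w t : ℂ) ∂μ)
      {z : ℂ | 0 < z.re} := by
  intro z hz
  have hz : 0 < z.re := hz
  have hmeas (ζ : ℂ) : AEStronglyMeasurable
      (fun t => Complex.exp (-ζ * (φ t : ℂ)) * (w t : ℂ)) μ := by
    refine Measurable.aestronglyMeasurable ?_
    fun_prop
  have hmeas' : AEStronglyMeasurable
      (fun t => -(φ t : ℂ) * (Complex.exp (-z * (φ t : ℂ)) * (w t : ℂ))) μ := by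
    refine Measurable.aestronglyMeasurable ?_
    fun_prop
  have hs : {ζ : ℂ | z.re / 2 < ζ.re} ∈ nhds z :=
    (Complex.isOpen_re_gt _).mem_nhds (by simp only [Set.mem_ofPred_eq]; linarith)
  have hnorm (ζ : ℂ) (t : ℝ) : ‖Complex.exp (-ζ * (φ t : ℂ)) * (w t : ℂ)‖ =
      Real.exp (-ζ.re * φ t) * |w t| := by
    simp [Complex.norm_exp]
  have key := hasDerivAt_integral_of_dominated_loc_of_deriv_le (μ := μ)
    (F := fun (ζ : ℂ) t => Complex.exp (-ζ * (φ t : ℂ)) * (w t : ℂ))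
    (F' := fun (ζ : ℂ) t => -(φ t : ℂ) * (Complex.exp (-ζ * (φ t : ℂ)) * (w t : ℂ)))
    (bound := fun t => (4 / z.re) * ‖Real.exp (-(z.re / 4) * φ t) * w t‖)
    hs (Filter.Eventually.of_forall hmeas) ?_ hmeas' ?_
    ((hint (z.re / 4) (by positivity)).norm.const_mul _) ?_
  · exact key.2.differentiableAt.differentiableWithinAt
  · refine (hint z.re hz).mono (hmeas z) (Filter.Eventually.of_forall fun t => ?_)
    rw [hnorm]
    simp
  · filter_upwards [hφ0] with t ht ζ hζ
    have hζ : z.re / 2 < ζ.re := hζ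
    rw [norm_mul, hnorm, norm_neg, Complex.norm_real, Real.norm_eq_abs, abs_of_nonneg ht,
      norm_mul, Real.norm_eq_abs, Real.norm_eq_abs, abs_of_pos (Real.exp_pos _),
      ← mul_assoc, ← mul_assoc]
    refine mul_le_mul_of_nonneg_right ?_ (abs_nonneg _)
    have h1 : φ t ≤ 4 / z.re * Real.exp (z.re / 4 * φ t) := by
      have := Real.add_one_le_exp (z.re / 4 * φ t)
      rw [div_mul_eq_mul_div, le_div_iff₀ hz]
      linarith
    calc φ t * Real.exp (-ζ.re * φ t)
        ≤ (4 / z.re * Real.exp (z.re / 4 * φ t)) * Real.exp (-(z.re / 2) * φ t) := by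
          gcongr
      _ = 4 / z.re * Real.exp (-(z.re / 4) * φ t) := by
          rw [mul_assoc, ← Real.exp_add]
          ring_nf
  · refine Filter.Eventually.of_forall fun t ζ _ => ?_
    have h := (((hasDerivAt_id ζ).neg.mul_const (φ t : ℂ)).cexp).mul_const (w t : ℂ)
    refine h.congr_deriv ?_
    simp
    ring

theorem integrableOn_one_add_mul_exp_neg_mul {b : ℝ} (hb : 0 < b) :
    IntegrableOn (fun t : ℝ => (1 + t) * Real.exp (-b * t)) (Set.Ioi 0) := by
  have h1 := exp_neg_integrableOn_Ioi 0 hb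
  have h2 := integrableOn_rpow_mul_exp_neg_mul_rpow (s := 1) (p := 1) (by norm_num) one_pos hb
  refine (h1.add h2).congr_fun (fun t _ => ?_) measurableSet_Ioi
  simp
  ring

theorem integrableOn_exp_neg_mul_mul_exp_neg_div {p x : ℝ} (hp : 0 < p) (hx : 0 < x) :
    IntegrableOn (fun t : ℝ => Real.exp (-x * t) * (t * Real.exp (-p / t))) (Set.Ioi 0) := by
  refine (integrableOn_one_add_mul_exp_neg_mul hx).mono' ?_ ?_
  · refine Measurable.aestronglyMeasurable ?_
    fun_prop
  · filter_upwards [ae_restrict_mem measurableSet_Ioi] with t (ht : 0 < t)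
    have h1 : Real.exp (-p / t) ≤ 1 := by
      rw [Real.exp_le_one_iff]
      exact div_nonpos_of_nonpos_of_nonneg (by linarith) ht.le
    rw [Real.norm_of_nonneg (by positivity), mul_comm (1 + t)]
    gcongr
    nlinarith

theorem image_const_mul_exp_univ {c : ℝ} (hc : 0 < c) :
    (fun u : ℝ => c * Real.exp u) '' Set.univ = Set.Ioi 0 := by
  ext t
  simp only [Set.image_univ, Set.mem_range, Set.mem_Ioi]
  refine ⟨?_, fun ht => ⟨Real.log (t / c), ?_⟩⟩
  · rintro ⟨u, rfl⟩
    positivity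
  · rw [Real.exp_log (by positivity)]
    field_simp

theorem sqrt_div_smul_exp_neg_mul {p x : ℝ} (hp : 0 < p) (hx : 0 < x) (u : ℝ) :
    |√(p / x) * Real.exp u| • (Real.exp (-x * (√(p / x) * Real.exp u)) *
      (√(p / x) * Real.exp u * Real.exp (-p / (√(p / x) * Real.exp u)))) =
    p / x * (Real.exp (-(2 * √(p * x)) * Real.cosh u) * Real.exp (2 * u)) := by
  have hc : 0 < √(p / x) := by positivity
  have hcc : √(p / x) * √(p / x) = p / x := Real.mul_self_sqrt (by positivity)
  have hs : √(p * x) = x * √(p / x) := by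
    rw [Real.sqrt_eq_iff_mul_self_eq_of_pos (by positivity)]
    calc x * √(p / x) * (x * √(p / x)) = x * x * (√(p / x) * √(p / x)) := by ring
      _ = p * x := by rw [hcc]; field_simp
  have hd : -p / (√(p / x) * Real.exp u) = -(x * √(p / x) * Real.exp (-u)) := by
    rw [div_eq_iff (by positivity), Real.exp_neg]
    have : p = x * (√(p / x) * √(p / x)) := by rw [hcc]; field_simp
    field_simp
    nlinarith
  rw [abs_of_pos (by positivity), hd, hs, Real.cosh_eq, smul_eq_mul, two_mul u, Real.exp_add u u]
  have : Real.exp (-(2 * (x * √(p / x))) * ((Real.exp u + Real.exp (-u)) / 2)) =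
      Real.exp (-x * (√(p / x) * Real.exp u)) * Real.exp (-(x * √(p / x) * Real.exp (-u))) := by
    rw [← Real.exp_add]
    ring_nf
  rw [this]
  linear_combination (Real.exp u * Real.exp u *
    (Real.exp (-x * (√(p / x) * Real.exp u)) * Real.exp (-(x * √(p / x) * Real.exp (-u))))) * hcc

theorem hasDerivWithinAt_const_mul_exp (c : ℝ) :
    ∀ u ∈ (Set.univ : Set ℝ),
      HasDerivWithinAt (fun u : ℝ => c * Real.exp u) (c * Real.exp u) Set.univ u :=
  fun u _ => ((Real.hasDerivAt_exp u).const_mul c).hasDerivWithinAt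

theorem injOn_const_mul_exp {c : ℝ} (hc : 0 < c) :
    Set.InjOn (fun u : ℝ => c * Real.exp u) Set.univ :=
  fun _ _ _ _ h => Real.exp_injective (mul_left_cancel₀ hc.ne' h)

theorem integrable_exp_neg_mul_cosh_mul_exp {y : ℝ} (hy : 0 < y) :
    Integrable (fun u : ℝ => Real.exp (-y * Real.cosh u) * Real.exp (2 * u)) := by
  have h2 : 0 < y / 2 := by positivity
  have hc : 0 < √(y / 2 / (y / 2)) := by positivity
  have h := integrableOn_exp_neg_mul_mul_exp_neg_div h2 h2
  rw [← image_const_mul_exp_univ hc, integrableOn_image_iff_integrableOn_abs_deriv_smul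
    MeasurableSet.univ (hasDerivWithinAt_const_mul_exp _) (injOn_const_mul_exp hc),
    integrableOn_univ] at h
  refine h.congr (Filter.Eventually.of_forall fun u => ?_)
  simp only [sqrt_div_smul_exp_neg_mul h2 h2]
  rw [div_self h2.ne', one_mul, Real.sqrt_mul_self h2.le]
  ring_nf

theorem integrable_exp_neg_mul_cosh_mul_cosh {y : ℝ} (hy : 0 < y) :
    Integrable (fun u : ℝ => Real.exp (-y * Real.cosh u) * Real.cosh (2 * u)) := by
  have h := integrable_exp_neg_mul_cosh_mul_exp hy
  refine ((h.add h.comp_neg).div_const 2).congr (Filter.Eventually.of_forall fun u => ?_)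
  simp [Real.cosh_eq (2 * u)]
  ring

theorem integral_exp_neg_mul_mul_exp_neg_div {p x : ℝ} (hp : 0 < p) (hx : 0 < x) :
    ∫ t in Set.Ioi (0 : ℝ), Real.exp (-x * t) * (t * Real.exp (-p / t)) =
      2 * (p / x) * besselK 2 (2 * √(p * x)) := by
  have hc : 0 < √(p / x) := by positivity
  have hy : 0 < 2 * √(p * x) := by positivity
  have h := integrable_exp_neg_mul_cosh_mul_exp hy
  rw [← image_const_mul_exp_univ hc, integral_image_eq_integral_abs_deriv_smul
    MeasurableSet.univ (hasDerivWithinAt_const_mul_exp _) (injOn_const_mul_exp hc),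
    setIntegral_univ]
  simp only [sqrt_div_smul_exp_neg_mul hp hx]
  rw [integral_const_mul]
  have hsym : ∫ u : ℝ, Real.exp (-(2 * √(p * x)) * Real.cosh u) * Real.exp (2 * u) =
      ∫ u : ℝ, Real.exp (-(2 * √(p * x)) * Real.cosh u) * Real.cosh (2 * u) := by
    have hneg := integral_neg_eq_self
      (fun u : ℝ => Real.exp (-(2 * √(p * x)) * Real.cosh u) * Real.exp (2 * u)) volume
    have hadd := integral_add h h.comp_neg
    rw [hneg] at hadd
    rw [← mul_right_inj' (two_ne_zero (α := ℝ)), two_mul, ← hadd, ← integral_const_mul]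
    refine integral_congr_ae (Filter.Eventually.of_forall fun u => ?_)
    simp [Real.cosh_eq (2 * u)]
    ring
  have habs := integral_comp_abs
    (f := fun u : ℝ => Real.exp (-(2 * √(p * x)) * Real.cosh u) * Real.cosh (2 * u))
  have heven : ∀ u : ℝ, Real.cosh (2 * |u|) = Real.cosh (2 * u) := fun u => by
    rw [← Real.cosh_abs (2 * u), abs_mul, abs_two]
  simp only [Real.cosh_abs, heven] at habs
  rw [hsym, habs, besselK]
  ring

theorem re_cpow_one_half_pos {z : ℂ} (hz : 0 < z.re) : 0 < (z ^ (1 / 2 : ℂ)).re := by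
  rw [one_div, Complex.cpow_inv_two_re]
  have := norm_nonneg z
  positivity

/-- The Laplace transform of `t * exp (-p / t)`. -/
theorem integral_cexp_neg_mul_mul_exp_neg_div {p : ℝ} (hp : 0 < p) {a : ℂ} (ha : 0 < a.re) :
    ∫ t in Set.Ioi (0 : ℝ), Complex.exp (-a * (t : ℂ)) * ((t * Real.exp (-p / t) : ℝ) : ℂ) =
      2 * (p / a) * besselKC 2 (2 * ((p : ℂ) * a) ^ (1 / 2 : ℂ)) := by
  have hU : IsOpen {z : ℂ | 0 < z.re} := Complex.isOpen_re_gt 0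
  have hL : DifferentiableOn ℂ (fun z : ℂ => ∫ t in Set.Ioi (0 : ℝ),
      Complex.exp (-z * (t : ℂ)) * ((t * Real.exp (-p / t) : ℝ) : ℂ)) {z : ℂ | 0 < z.re} :=
    differentiableOn_integral_cexp_neg_mul (φ := fun t => t) (by fun_prop) (by fun_prop)
      ((ae_restrict_mem measurableSet_Ioi).mono fun t ht => le_of_lt ht)
      (fun x hx => integrableOn_exp_neg_mul_mul_exp_neg_div hp hx)
  have hK : DifferentiableOn ℂ (besselKC 2) {z : ℂ | 0 < z.re} :=
    differentiableOn_integral_cexp_neg_mul (φ := Real.cosh) (w := fun t => Real.cosh (2 * t))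
      (by fun_prop) (by fun_prop) (Filter.Eventually.of_forall fun t => (Real.cosh_pos t).le)
      (fun x hx => (integrable_exp_neg_mul_cosh_mul_cosh hx).integrableOn)
  have hre {z : ℂ} (hz : 0 < z.re) : 0 < ((p : ℂ) * z).re := by
    rw [Complex.re_ofReal_mul]
    positivity
  have hR : DifferentiableOn ℂ (fun z : ℂ =>
      2 * (p / z) * besselKC 2 (2 * ((p : ℂ) * z) ^ (1 / 2 : ℂ))) {z : ℂ | 0 < z.re} := by
    refine DifferentiableOn.fun_mul ?_ (DifferentiableOn.comp (g := besselKC 2)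
      (f := fun z : ℂ => 2 * ((p : ℂ) * z) ^ (1 / 2 : ℂ)) hK ?_ ?_)
    · refine (DifferentiableOn.div (by fun_prop) (by fun_prop) fun z hz h0 => ?_).const_mul _
      simp [h0] at hz
    · refine (DifferentiableOn.cpow (by fun_prop) (by fun_prop) fun z hz => ?_).const_mul _
      exact Or.inl (hre hz)
    · intro z hz
      have := re_cpow_one_half_pos (hre hz)
      simp only [Set.mem_ofPred_eq, Complex.mul_re, Complex.re_ofNat, Complex.im_ofNat, zero_mul,
        sub_zero]
      positivity
  refine AnalyticOnNhd.eqOn_of_preconnected_of_frequently_eq (hL.analyticOnNhd hU)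
    (hR.analyticOnNhd hU) (convex_halfSpace_re_gt 0).isPreconnected (z₀ := 1) (by simp) ?_ ha
  have htend : Filter.Tendsto (fun x : ℝ => (x : ℂ)) (nhdsWithin 1 {1}ᶜ) (nhdsWithin 1 {1}ᶜ) := by
    refine tendsto_nhdsWithin_iff.2 ⟨?_, ?_⟩
    · have := Complex.continuous_ofReal.tendsto (1 : ℝ)
      rw [Complex.ofReal_one] at this
      exact this.mono_left nhdsWithin_le_nhds
    · filter_upwards [self_mem_nhdsWithin] with x hx
      simpa using hx
  refine htend.frequently (Filter.Eventually.frequently ?_)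
  filter_upwards [nhdsWithin_le_nhds (lt_mem_nhds (zero_lt_one (α := ℝ)))] with x hx
  have hK' : besselKC 2 (2 * ((p : ℂ) * x) ^ (1 / 2 : ℂ)) =
      (besselK 2 (2 * √(p * x)) : ℂ) := by
    have : 2 * ((p : ℂ) * x) ^ (1 / 2 : ℂ) = ((2 * √(p * x) : ℝ) : ℂ) := by
      rw [Real.sqrt_eq_rpow, Complex.ofReal_mul, Complex.ofReal_cpow (by positivity)]
      push_cast
      rfl
    rw [this, besselK, besselKC, ← integral_complex_ofReal]
    push_cast
    rfl
  rw [hK']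
  have := congrArg (fun r : ℝ => (r : ℂ)) (integral_exp_neg_mul_mul_exp_neg_div hp hx)
  simp only [← integral_complex_ofReal] at this
  push_cast at this ⊢
  exact this

theorem div_exp_sub_one_le {t : ℝ} (ht : 0 < t) :
    t / (Real.exp t - 1) ≤ (1 + t) * Real.exp (-t) := by
  have h1 : 0 < Real.exp t - 1 := by linarith [Real.add_one_lt_exp ht.ne']
  have h2 : (1 + t) * Real.exp (-t) ≤ 1 := by
    rw [Real.exp_neg, mul_inv_le_iff₀ (Real.exp_pos t)]
    linarith [Real.add_one_le_exp t]
  have h3 : Real.exp (-t) * Real.exp t = 1 := by rw [← Real.exp_add]; simp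
  rw [div_le_iff₀ h1]
  nlinarith

theorem mul_exp_neg_div_div_exp_sub_one_le {p t : ℝ} (hp : 0 < p) (ht : 0 < t) :
    t * Real.exp (-p / t) / (Real.exp t - 1) ≤ (1 + t) * Real.exp (-t) := by
  have h1 : 0 < Real.exp t - 1 := by linarith [Real.add_one_lt_exp ht.ne']
  refine le_trans ?_ (div_exp_sub_one_le ht)
  gcongr
  refine mul_le_of_le_one_right ht.le ?_
  rw [Real.exp_le_one_iff]
  exact div_nonpos_of_nonpos_of_nonneg (by linarith) ht.le

theorem mul_exp_neg_div_div_exp_sub_one_nonneg {t : ℝ} (p : ℝ) (ht : 0 < t) :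
    0 ≤ t * Real.exp (-p / t) / (Real.exp t - 1) := by
  have h1 : 0 < Real.exp t - 1 := by linarith [Real.add_one_lt_exp ht.ne']
  positivity

theorem integrableOn_sinh_mul {p γ : ℝ} (hp : 0 < p) (hγ0 : 0 < γ) (hγ1 : γ < 1) :
    IntegrableOn (fun t : ℝ => Real.sinh (γ * t) * (t * Real.exp (-p / t) / (Real.exp t - 1)))
      (Set.Ioi 0) := by
  refine (integrableOn_one_add_mul_exp_neg_mul (sub_pos.2 hγ1)).mono' ?_ ?_
  · refine Measurable.aestronglyMeasurable ?_
    fun_prop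
  · filter_upwards [ae_restrict_mem measurableSet_Ioi] with t (ht : 0 < t)
    have h0 := mul_exp_neg_div_div_exp_sub_one_nonneg p ht
    have h1 : 0 ≤ Real.sinh (γ * t) := Real.sinh_nonneg_iff.2 (by positivity)
    have h2 : Real.sinh (γ * t) ≤ Real.exp (γ * t) := by
      rw [Real.sinh_eq]
      linarith [Real.exp_pos (γ * t), Real.exp_pos (-(γ * t))]
    rw [Real.norm_of_nonneg (by positivity)]
    calc Real.sinh (γ * t) * (t * Real.exp (-p / t) / (Real.exp t - 1))
        ≤ Real.exp (γ * t) * ((1 + t) * Real.exp (-t)) := by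
          gcongr
          exact mul_exp_neg_div_div_exp_sub_one_le hp ht
      _ = (1 + t) * Real.exp (-(1 - γ) * t) := by
          rw [mul_left_comm, ← Real.exp_add]
          ring_nf

theorem mathieu_term_eq_integral {p γ : ℝ} (hγ0 : 0 < γ) (n : ℕ) :
    (-1 : ℝ) ^ n * (Real.Gamma (1 + n + 1) / (n.factorial * Real.Gamma (1 + 1))) *
      zetaP p (2 * 1 + 2 * n + 1) * γ ^ (2 * n) =
    1 / (2 * γ) * ∫ t in Set.Ioi (0 : ℝ), (-1) ^ n * (γ * t) ^ (2 * n + 1) /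
      ((2 * n + 1).factorial : ℝ) * (t * Real.exp (-p / t) / (Real.exp t - 1)) := by
  have hint : ∫ t in Set.Ioi (0 : ℝ), (-1) ^ n * (γ * t) ^ (2 * n + 1) /
      ((2 * n + 1).factorial : ℝ) * (t * Real.exp (-p / t) / (Real.exp t - 1)) =
      (-1) ^ n * γ ^ (2 * n + 1) / ((2 * n + 1).factorial : ℝ) *
        ∫ t in Set.Ioi (0 : ℝ), t ^ (2 * 1 + 2 * (n : ℝ) + 1 - 1) * Real.exp (-p / t) /
          (Real.exp t - 1) := by
    rw [← integral_const_mul]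
    refine integral_congr_ae (Filter.Eventually.of_forall fun t => ?_)
    have : 2 * 1 + 2 * (n : ℝ) + 1 - 1 = ((2 * n + 2 : ℕ) : ℝ) := by
      push_cast
      ring
    simp only [this, Real.rpow_natCast]
    ring
  have hG1 : Real.Gamma (1 + n + 1) = (n + 1) * n.factorial := by
    have := Real.Gamma_nat_eq_factorial (n + 1)
    rw [Nat.factorial_succ] at this
    push_cast at this
    rw [← this]
    ring_nf
  have hG2 : Real.Gamma (1 + 1) = 1 := by norm_num
  have hG3 : Real.Gamma (2 * 1 + 2 * n + 1) = (2 * n + 2) * (2 * n + 1).factorial := by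
    have := Real.Gamma_nat_eq_factorial (2 * n + 2)
    rw [Nat.factorial_succ] at this
    push_cast at this
    rw [show 2 * 1 + 2 * (n : ℝ) + 1 = 2 * n + 2 + 1 by ring, this]
    ring
  rw [hint, zetaP, hG1, hG2, hG3]
  have h1 : (n.factorial : ℝ) ≠ 0 := by positivity
  have h2 : ((2 * n + 1).factorial : ℝ) ≠ 0 := by positivity
  field_simp
  ring

theorem mathieuS_one_eq_integral {p γ : ℝ} (hp : 0 < p) (hγ0 : 0 < γ) (hγ1 : γ < 1) :
    mathieuS 1 p γ = 1 / γ * ∫ t in Set.Ioi (0 : ℝ),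
      Real.sin (γ * t) * (t * Real.exp (-p / t) / (Real.exp t - 1)) := by
  have hsinh (t : ℝ) := (Real.hasSum_sinh (γ * t)).mul_right
    (t * Real.exp (-p / t) / (Real.exp t - 1))
  have key := hasSum_integral_of_dominated_convergence
    (μ := volume.restrict (Set.Ioi (0 : ℝ)))
    (F := fun (n : ℕ) t => (-1) ^ n * (γ * t) ^ (2 * n + 1) /
      ((2 * n + 1).factorial : ℝ) * (t * Real.exp (-p / t) / (Real.exp t - 1)))
    (f := fun t => Real.sin (γ * t) * (t * Real.exp (-p / t) / (Real.exp t - 1)))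
    (fun n t => (γ * t) ^ (2 * n + 1) /
      ((2 * n + 1).factorial : ℝ) * (t * Real.exp (-p / t) / (Real.exp t - 1)))
    (fun n => Measurable.aestronglyMeasurable (by fun_prop)) (fun n => ?_)
    (Filter.Eventually.of_forall fun t => (hsinh t).summable) ?_
    (Filter.Eventually.of_forall fun t => (Real.hasSum_sin (γ * t)).mul_right _)
  · unfold mathieuS
    simp only [mathieu_term_eq_integral hγ0]
    rw [(key.mul_left _).tsum_eq]
    field_simp
  · filter_upwards [ae_restrict_mem measurableSet_Ioi] with t (ht : 0 < t)
    have h0 := mul_exp_neg_div_div_exp_sub_one_nonneg p ht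
    rw [norm_mul, norm_div, norm_mul, norm_pow, norm_neg, norm_one, one_pow, one_mul,
      Real.norm_of_nonneg h0, Real.norm_of_nonneg (by positivity : 0 ≤ (γ * t) ^ (2 * n + 1)),
      Real.norm_of_nonneg (by positivity : (0 : ℝ) ≤ (2 * n + 1).factorial)]
  · simp only [fun t => (hsinh t).tsum_eq]
    exact integrableOn_sinh_mul hp hγ0 hγ1

theorem hasSum_exp_neg_succ_mul {t : ℝ} (ht : 0 < t) :
    HasSum (fun k : ℕ => Real.exp (-((k : ℝ) + 1) * t)) (Real.exp t - 1)⁻¹ := by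
  have h := (hasSum_geometric_of_lt_one (Real.exp_pos (-t)).le
    (Real.exp_lt_one_iff.2 (neg_lt_zero.2 ht))).mul_left (Real.exp (-t))
  have h1 : 0 < Real.exp t - 1 := by linarith [Real.add_one_lt_exp ht.ne']
  have h3 : Real.exp (-t) * Real.exp t = 1 := by rw [← Real.exp_add]; simp
  have h2 : Real.exp (-t) * (1 - Real.exp (-t))⁻¹ = (Real.exp t - 1)⁻¹ := by
    have : 1 - Real.exp (-t) = Real.exp (-t) * (Real.exp t - 1) := by rw [mul_sub, h3, mul_one]
    rw [this, mul_inv, mul_inv_cancel_left₀ (Real.exp_pos _).ne']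
  rw [h2] at h
  refine h.congr_fun fun k => ?_
  rw [← Real.exp_nat_mul, ← Real.exp_add]
  ring_nf

theorem hasSum_integral_sin_mul {p : ℝ} (hp : 0 < p) (γ : ℝ) :
    HasSum (fun k : ℕ => ∫ t in Set.Ioi (0 : ℝ),
        Real.sin (γ * t) * (t * Real.exp (-p / t) * Real.exp (-((k : ℝ) + 1) * t)))
      (∫ t in Set.Ioi (0 : ℝ),
        Real.sin (γ * t) * (t * Real.exp (-p / t) / (Real.exp t - 1))) := by
  have hsum {t : ℝ} (ht : 0 < t) := (hasSum_exp_neg_succ_mul ht).mul_left (t * Real.exp (-p / t))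
  refine hasSum_integral_of_dominated_convergence
    (fun k t => t * Real.exp (-p / t) * Real.exp (-((k : ℝ) + 1) * t))
    (fun n => Measurable.aestronglyMeasurable (by fun_prop)) (fun n => ?_) ?_ ?_ ?_
  · filter_upwards [ae_restrict_mem measurableSet_Ioi] with t (ht : 0 < t)
    rw [norm_mul, Real.norm_of_nonneg
      (by positivity : 0 ≤ t * Real.exp (-p / t) * Real.exp (-((n : ℝ) + 1) * t))]
    exact mul_le_of_le_one_left (by positivity) (Real.abs_sin_le_one _)
  · filter_upwards [ae_restrict_mem measurableSet_Ioi] with t (ht : 0 < t)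
    exact (hsum ht).summable
  · have hint := integrableOn_one_add_mul_exp_neg_mul one_pos
    have : IntegrableOn (fun t : ℝ => t * Real.exp (-p / t) / (Real.exp t - 1))
        (Set.Ioi 0) := by
      refine hint.mono' (Measurable.aestronglyMeasurable (by fun_prop)) ?_
      filter_upwards [ae_restrict_mem measurableSet_Ioi] with t (ht : 0 < t)
      rw [Real.norm_of_nonneg (mul_exp_neg_div_div_exp_sub_one_nonneg p ht), neg_one_mul]
      exact mul_exp_neg_div_div_exp_sub_one_le hp ht
    refine this.congr_fun (fun t ht => ?_) measurableSet_Ioi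
    exact (hsum ht).tsum_eq.symm
  · filter_upwards [ae_restrict_mem measurableSet_Ioi] with t (ht : 0 < t)
    exact (hsum ht).mul_left _

theorem integrableOn_cexp_neg_mul_mul_exp_neg_div {p : ℝ} (hp : 0 < p) {a : ℂ}
    (ha : 0 < a.re) :
    IntegrableOn (fun t : ℝ => Complex.exp (-a * (t : ℂ)) *
      ((t * Real.exp (-p / t) : ℝ) : ℂ)) (Set.Ioi 0) := by
  refine Integrable.mono (integrableOn_exp_neg_mul_mul_exp_neg_div hp ha)
    (Measurable.aestronglyMeasurable (by fun_prop)) (Filter.Eventually.of_forall fun t => ?_)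
  rw [norm_mul, norm_mul, Complex.norm_exp, Complex.norm_real]
  simp

theorem integral_sin_mul_eq_besselKC {p : ℝ} (hp : 0 < p) (γ : ℝ) (k : ℕ) :
    ((∫ t in Set.Ioi (0 : ℝ), Real.sin (γ * t) *
      (t * Real.exp (-p / t) * Real.exp (-((k : ℝ) + 1) * t)) : ℝ) : ℂ) =
    Complex.I * p *
      (besselKC 2 (2 * ((p : ℂ) * (((k : ℂ) + 1) + Complex.I * γ)) ^ (1/2 : ℂ)) /
          (((k : ℂ) + 1) + Complex.I * γ) -
        besselKC 2 (2 * ((p : ℂ) * (((k : ℂ) + 1) - Complex.I * γ)) ^ (1/2 : ℂ)) /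
          (((k : ℂ) + 1) - Complex.I * γ)) := by
  have h1 : 0 < (((k : ℂ) + 1) + Complex.I * γ).re := by simp; positivity
  have h2 : 0 < (((k : ℂ) + 1) - Complex.I * γ).re := by simp; positivity
  have hsin (t : ℝ) : ((Real.sin (γ * t) *
      (t * Real.exp (-p / t) * Real.exp (-((k : ℝ) + 1) * t)) : ℝ) : ℂ) =
      Complex.I / 2 * (Complex.exp (-(((k : ℂ) + 1) + Complex.I * γ) * (t : ℂ)) *
          ((t * Real.exp (-p / t) : ℝ) : ℂ) -
        Complex.exp (-(((k : ℂ) + 1) - Complex.I * γ) * (t : ℂ)) *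
          ((t * Real.exp (-p / t) : ℝ) : ℂ)) := by
    have e1 : Complex.exp (-(((k : ℂ) + 1) + Complex.I * γ) * (t : ℂ)) =
        Complex.exp (-((k : ℂ) + 1) * t) * Complex.exp (-(γ * t) * Complex.I) := by
      rw [← Complex.exp_add]
      ring_nf
    have e2 : Complex.exp (-(((k : ℂ) + 1) - Complex.I * γ) * (t : ℂ)) =
        Complex.exp (-((k : ℂ) + 1) * t) * Complex.exp (γ * t * Complex.I) := by
      rw [← Complex.exp_add]
      ring_nf
    rw [e1, e2]
    push_cast
    rw [Complex.sin]
    ring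
  rw [← integral_complex_ofReal]
  simp only [hsin]
  rw [integral_const_mul, integral_sub (integrableOn_cexp_neg_mul_mul_exp_neg_div hp h1)
    (integrableOn_cexp_neg_mul_mul_exp_neg_div hp h2),
    integral_cexp_neg_mul_mul_exp_neg_div hp h1, integral_cexp_neg_mul_mul_exp_neg_div hp h2]
  ring

theorem stmt4 (p γ : ℝ) (hp : 0 < p) (hγ0 : 0 < γ) (hγ1 : γ < 1) :
    (mathieuS 1 p γ : ℂ) =
      Complex.I * (p : ℂ) / (γ : ℂ) *
        ∑' k : ℕ,
          (besselKC 2 (2 * ((p : ℂ) * (((k : ℂ) + 1) + Complex.I * γ)) ^ (1/2 : ℂ)) /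
              (((k : ℂ) + 1) + Complex.I * γ) -
            besselKC 2 (2 * ((p : ℂ) * (((k : ℂ) + 1) - Complex.I * γ)) ^ (1/2 : ℂ)) /
              (((k : ℂ) + 1) - Complex.I * γ)) := by
  have hsum := Complex.hasSum_ofReal.2 (hasSum_integral_sin_mul hp γ)
  simp only [integral_sin_mul_eq_besselKC hp] at hsum
  rw [mathieuS_one_eq_integral hp hγ0 hγ1, Complex.ofReal_mul, ← hsum.tsum_eq, tsum_mul_left]
  push_cast
  ring
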